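/- arXiv:1212.0209 — 7 statements merged into one kernel-verified Lean document; each statement's English description precedes it below -/
import Mathlib

section
/- Let q > 1 be an integer and let M = {1, q, m₃, m₄, …, m_s} be a finite set of positive integers with 1 < q < m₃ < m₄ < … < m_s. If mᵢ ≡ ±1 (mod q+1) for every integer i ∈ {3, 4, …, s}, then μ(M) = 1/2 if q is odd, and μ(M) = q/(2(q+1)) if q is even. -/
open Filter Set Pointwise

/-- `countBelow S x` is the number of elements `n ∈ S` with `n ≤ x`. -/
noncomputable def countBelow (S : Set ℕ) (x : ℕ) : ℕ := (S ∩ Set.Iic x).ncard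

/-- The upper asymptotic density `δ̄(S) = limsup_{x→∞} S(x)/x` of a set `S ⊆ ℕ`. -/
noncomputable def upperDensity (S : Set ℕ) : ℝ :=
  Filter.limsup (fun x : ℕ => (countBelow S x : ℝ) / x) Filter.atTop

/-- `S` is an `M`-set: for all `a, b ∈ S`, the difference `a - b` does not lie in `M`. -/
def IsMSet (M S : Set ℕ) : Prop := ∀ a ∈ S, ∀ b ∈ S, a - b ∉ M

/-- Motzkin's quantity `μ(M)`: the supremum of the upper densities of all `M`-sets. -/
noncomputable def muM (M : Set ℕ) : ℝ :=
  sSup {x : ℝ | ∃ S : Set ℕ, IsMSet M S ∧ x = upperDensity S}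

open Classical in
lemma countBelow_eq_count (S : Set ℕ) (x : ℕ) :
    countBelow S x = Nat.count (· ∈ S) (x + 1) := by
  have h : S ∩ Set.Iic x = ↑((Finset.range (x + 1)).filter (· ∈ S)) := by
    ext n
    simp [and_comm]
  rw [countBelow, h, Set.ncard_coe_finset, Nat.count_eq_card_filter_range]

open Classical in
lemma count_mul_le {S : Set ℕ} {p k : ℕ}
    (h : ∀ t, Nat.count (fun i => p * t + i ∈ S) p ≤ k) (t : ℕ) :
    Nat.count (· ∈ S) (p * t) ≤ k * t := by
  induction t with
  | zero => simp
  | succ t ih =>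
    rw [mul_add_one, Nat.count_add, mul_add_one]
    exact add_le_add ih (h t)

open Classical in
lemma le_count_mul {S : Set ℕ} {p k : ℕ}
    (h : ∀ t, k ≤ Nat.count (fun i => p * t + i ∈ S) p) (t : ℕ) :
    k * t ≤ Nat.count (· ∈ S) (p * t) := by
  induction t with
  | zero => simp
  | succ t ih =>
    rw [mul_add_one, mul_add_one, Nat.count_add]
    exact add_le_add ih (h t)

lemma countBelow_div_le (S : Set ℕ) (x : ℕ) : (countBelow S x : ℝ) / x ≤ 2 := by
  classical
  rcases Nat.eq_zero_or_pos x with rfl | hx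
  · simp
  · rw [div_le_iff₀ (by exact_mod_cast hx), countBelow_eq_count]
    have h : Nat.count (· ∈ S) (x + 1) ≤ 2 * x := le_trans (Nat.count_le _) (by omega)
    exact_mod_cast h

lemma isBoundedUnder_countBelow_div (S : Set ℕ) :
    IsBoundedUnder (· ≤ ·) atTop (fun x : ℕ => (countBelow S x : ℝ) / x) :=
  isBoundedUnder_of ⟨2, countBelow_div_le S⟩

lemma isCoboundedUnder_countBelow_div (S : Set ℕ) :
    IsCoboundedUnder (· ≤ ·) atTop (fun x : ℕ => (countBelow S x : ℝ) / x) :=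
  (isBoundedUnder_of ⟨0, fun x => by positivity⟩ :
    IsBoundedUnder (· ≥ ·) atTop (fun x : ℕ => (countBelow S x : ℝ) / x)).isCoboundedUnder_le

open Classical in
lemma upperDensity_le {S : Set ℕ} {p k : ℕ} (hp : 0 < p)
    (h : ∀ t, Nat.count (fun i => p * t + i ∈ S) p ≤ k) :
    upperDensity S ≤ (k : ℝ) / p := by
  have hlim : Tendsto (fun x : ℕ => (k : ℝ) / p + (k : ℝ) / x) atTop (nhds ((k : ℝ) / p)) := by
    simpa using tendsto_const_nhds.add (tendsto_const_div_atTop_nhds_zero_nat (k : ℝ))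
  rw [← hlim.limsup_eq]
  refine limsup_le_limsup ?_ (isCoboundedUnder_countBelow_div S) hlim.isBoundedUnder_le
  filter_upwards [eventually_gt_atTop 0] with x hx
  have hp' : (0 : ℝ) < p := by exact_mod_cast hp
  have hx' : (0 : ℝ) < x := by exact_mod_cast hx
  have h1 : countBelow S x ≤ k * (x / p + 1) := by
    rw [countBelow_eq_count]
    exact (Nat.count_monotone _ (Nat.lt_mul_div_succ x hp)).trans (count_mul_le h _)
  have h2 : (countBelow S x : ℝ) ≤ k * (((x / p : ℕ) : ℝ) + 1) := by exact_mod_cast h1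
  have h3 : ((x / p : ℕ) : ℝ) ≤ (x : ℝ) / p := Nat.cast_div_le
  rw [div_le_iff₀ hx']
  calc (countBelow S x : ℝ) ≤ k * ((x : ℝ) / p + 1) := h2.trans (by gcongr)
    _ = ((k : ℝ) / p + (k : ℝ) / x) * x := by field_simp

open Classical in
lemma le_upperDensity {S : Set ℕ} {p k : ℕ} (hp : 0 < p)
    (h : ∀ t, k ≤ Nat.count (fun i => p * t + i ∈ S) p) :
    (k : ℝ) / p ≤ upperDensity S := by
  have hlim : Tendsto (fun x : ℕ => (k : ℝ) / p - (k : ℝ) / x) atTop (nhds ((k : ℝ) / p)) := by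
    simpa using tendsto_const_nhds.sub (tendsto_const_div_atTop_nhds_zero_nat (k : ℝ))
  rw [← hlim.limsup_eq]
  refine limsup_le_limsup ?_ hlim.isCoboundedUnder_le (isBoundedUnder_countBelow_div S)
  filter_upwards [eventually_gt_atTop 0] with x hx
  have hp' : (0 : ℝ) < p := by exact_mod_cast hp
  have hx' : (0 : ℝ) < x := by exact_mod_cast hx
  have h1 : k * (x / p) ≤ countBelow S x := by
    rw [countBelow_eq_count]
    exact (le_count_mul h _).trans
      (Nat.count_monotone _ ((Nat.mul_div_le x p).trans (Nat.le_succ x)))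
  have h2 : (k : ℝ) * ((x / p : ℕ) : ℝ) ≤ countBelow S x := by exact_mod_cast h1
  have h3 : (x : ℝ) / p - 1 ≤ ((x / p : ℕ) : ℝ) := by
    have h4 : x < p * (x / p + 1) := Nat.lt_mul_div_succ x hp
    have h5 : (x : ℝ) < p * (((x / p : ℕ) : ℝ) + 1) := by exact_mod_cast h4
    rw [sub_le_iff_le_add, div_le_iff₀ hp']
    linarith
  rw [le_div_iff₀ hx']
  calc ((k : ℝ) / p - (k : ℝ) / x) * x = k * ((x : ℝ) / p - 1) := by field_simp
    _ ≤ countBelow S x := (by gcongr : _ ≤ (k : ℝ) * ((x / p : ℕ) : ℝ)).trans h2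

open Classical in
lemma muM_eq_div {M S : Set ℕ} {p k : ℕ} (hp : 0 < p) (hS : IsMSet M S)
    (hlower : ∀ t, k ≤ Nat.count (fun i => p * t + i ∈ S) p)
    (hupper : ∀ T, IsMSet M T → ∀ t, Nat.count (fun i => p * t + i ∈ T) p ≤ k) :
    muM M = (k : ℝ) / p := by
  have hle : ∀ x ∈ {x : ℝ | ∃ T : Set ℕ, IsMSet M T ∧ x = upperDensity T}, x ≤ (k : ℝ) / p := by
    rintro x ⟨T, hT, rfl⟩
    exact upperDensity_le hp (hupper T hT)
  exact le_antisymm (csSup_le ⟨_, S, hS, rfl⟩ hle)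
    ((le_upperDensity hp hlower).trans (le_csSup ⟨_, hle⟩ ⟨S, hS, rfl⟩))

lemma count_two_mul_le (P : ℕ → Prop) [DecidablePred P] (h : ∀ i, ¬ (P i ∧ P (i + 1)))
    (k : ℕ) : Nat.count P (2 * k) ≤ k := by
  induction k with
  | zero => simp
  | succ k ih =>
    have := h (2 * k)
    rw [mul_add_one, Nat.count_succ, Nat.count_succ]
    split_ifs <;> first | omega | tauto

lemma count_two_mul_add_one_le (P : ℕ → Prop) [DecidablePred P]
    (h : ∀ i, ¬ (P i ∧ P (i + 1))) (k : ℕ) (h0 : ¬ (P 0 ∧ P (2 * k))) :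
    Nat.count P (2 * k + 1) ≤ k := by
  by_cases hP : P 0
  · rw [Nat.count_succ, if_neg fun hk => h0 ⟨hP, hk⟩]
    exact count_two_mul_le P h k
  · rw [Nat.count_succ', if_neg hP]
    exact count_two_mul_le (fun i => P (i + 1)) (fun i => h (i + 1)) k

lemma le_count_two_mul (P : ℕ → Prop) [DecidablePred P] (k : ℕ)
    (h : ∀ i < k, P (2 * i)) : k ≤ Nat.count P (2 * k) := by
  induction k with
  | zero => simp
  | succ k ih =>
    have h1 := ih fun i hi => h i (by omega)
    rw [mul_add_one, Nat.count_succ, Nat.count_succ, if_pos (h k (by omega))]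
    omega

lemma IsMSet.not_mem_add {M S : Set ℕ} (hS : IsMSet M S) {m : ℕ} (hm : m ∈ M) (a : ℕ) :
    ¬ (a ∈ S ∧ a + m ∈ S) := fun h => hS (a + m) h.2 a h.1 (by simpa using hm)

lemma muM_eq_half {M : Set ℕ} (h1M : 1 ∈ M) (hM : ∀ m ∈ M, Odd m) : muM M = 1 / 2 := by
  classical
  have h : muM M = ((1 : ℕ) : ℝ) / ((2 : ℕ) : ℝ) := by
    obtain ⟨S, hS⟩ : ∃ S : Set ℕ, ∀ n, n ∈ S ↔ Even n := ⟨{n | Even n}, fun _ => Iff.rfl⟩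
    refine muM_eq_div (S := S) two_pos ?_ (fun t => ?_) (fun T hT t => ?_)
    · intro a ha b hb hab
      rw [hS, Nat.even_iff] at ha hb
      have := Nat.odd_iff.1 (hM _ hab)
      omega
    · refine le_count_two_mul _ 1 fun i _ => ?_
      rw [hS, ← mul_add]
      exact even_two_mul _
    · exact count_two_mul_le _ (fun i => hT.not_mem_add h1M (2 * t + i)) 1
  simpa using h

lemma muM_eq_of_even {M : Set ℕ} {k : ℕ} (hk : 0 < k) (h1M : 1 ∈ M) (hqM : 2 * k ∈ M)
    (hM : ∀ m ∈ M, m % (2 * k + 1) = 1 ∨ m % (2 * k + 1) = 2 * k) :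
    muM M = (k : ℝ) / ((2 * k + 1 : ℕ) : ℝ) := by
  classical
  obtain ⟨S, hS⟩ : ∃ S : Set ℕ, ∀ n, n ∈ S ↔ n % (2 * k + 1) < 2 * k ∧
      Even (n % (2 * k + 1)) := ⟨{n | _}, fun _ => Iff.rfl⟩
  refine muM_eq_div (S := S) (Nat.succ_pos _) ?_ (fun t => ?_) (fun T hT t => ?_)
  · intro a ha b hb hab
    rw [hS, Nat.even_iff] at ha hb
    have hm := hM _ hab
    have hlt : b < a := by
      by_contra! hle
      rw [Nat.sub_eq_zero_of_le hle, Nat.zero_mod] at hm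
      omega
    have hadd : a % (2 * k + 1) =
        (b % (2 * k + 1) + (a - b) % (2 * k + 1)) % (2 * k + 1) := by
      rw [← Nat.add_mod, Nat.add_sub_cancel' hlt.le]
    rcases hm with hm | hm
    · rw [hm, Nat.mod_eq_of_lt (a := b % (2 * k + 1) + 1) (by omega)] at hadd
      omega
    · rw [hm] at hadd
      rcases Nat.eq_zero_or_pos (b % (2 * k + 1)) with h0 | h0
      · rw [h0, zero_add, Nat.mod_eq_of_lt (a := 2 * k) (by omega)] at hadd
        omega
      · rw [Nat.mod_eq_sub_mod (a := b % (2 * k + 1) + 2 * k) (by omega),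
          Nat.mod_eq_of_lt (a := b % (2 * k + 1) + 2 * k - (2 * k + 1)) (by omega)] at hadd
        omega
  · refine (le_count_two_mul _ k fun i hi => ?_).trans (Nat.count_monotone _ (Nat.le_succ _))
    rw [hS, Nat.mul_add_mod, Nat.mod_eq_of_lt (by omega)]
    exact ⟨by omega, even_two_mul i⟩
  · exact count_two_mul_add_one_le _ (fun i => hT.not_mem_add h1M ((2 * k + 1) * t + i)) k
      (hT.not_mem_add hqM ((2 * k + 1) * t))

/-- Theorem 1: If `M = {1, q, m₃, …, m_s}` with `1 < q < m₃ < ⋯ < m_s` and every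
`mᵢ ≡ ±1 (mod q+1)`, then `μ(M) = 1/2` if `q` is odd and `μ(M) = q/(2(q+1))` if `q` is even. -/
theorem stmt0 (q : ℕ) (hq : 1 < q) (M : Finset ℕ)
    (h1M : 1 ∈ M) (hqM : q ∈ M)
    (hrest : ∀ m ∈ M, m ≠ 1 → m ≠ q →
      q < m ∧ (m % (q + 1) = 1 ∨ m % (q + 1) = q)) :
    (Odd q → muM ↑M = 1 / 2) ∧
    (Even q → muM ↑M = (q : ℝ) / (2 * ((q : ℝ) + 1))) := by
  have hmod : ∀ m ∈ M, m % (q + 1) = 1 ∨ m % (q + 1) = q := by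
    intro m hm
    by_cases h1 : m = 1
    · subst h1
      exact Or.inl (Nat.mod_eq_of_lt (by omega))
    by_cases h2 : m = q
    · subst h2
      exact Or.inr (Nat.mod_eq_of_lt (Nat.lt_succ_self _))
    exact (hrest m hm h1 h2).2
  refine ⟨fun hodd => muM_eq_half (by exact_mod_cast h1M) fun m hm => ?_, fun heven => ?_⟩
  · have hdvd : 2 ∣ q + 1 := (hodd.add_one).two_dvd
    have hmm := Nat.mod_mod_of_dvd m hdvd
    rw [Nat.odd_iff] at hodd ⊢
    rcases hmod m hm with h | h <;> rw [h] at hmm <;> omega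
  · obtain ⟨k, rfl⟩ := heven.two_dvd
    rw [muM_eq_of_even (by omega) (by exact_mod_cast h1M) (by exact_mod_cast hqM) hmod]
    push_cast
    field_simp
end

section
/- If M = {a, aq, aq², …, aqⁿ}, where a, q, n are positive integers with q ≥ 2 (so M is a finite geometric progression), then μ(M) = 1/2 if q is odd, and μ(M) = q/(2(q+1)) if q is even. -/
open Filter Set Pointwise

open Classical in
/-- The indicator function of a set of naturals, with values in `ℕ`. -/
noncomputable def natIndicator (S : Set ℕ) (n : ℕ) : ℕ := if n ∈ S then 1 else 0

lemma natIndicator_le_one (S : Set ℕ) (n : ℕ) : natIndicator S n ≤ 1 := by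
  unfold natIndicator
  split_ifs <;> simp

lemma countBelow_eq_sum (S : Set ℕ) (x : ℕ) :
    countBelow S x = ∑ i ∈ Finset.range (x + 1), natIndicator S i := by
  classical
  unfold countBelow natIndicator
  rw [← Finset.card_filter, ← Set.ncard_coe_finset]
  congr 1
  ext i
  simp [and_comm]

lemma sum_natIndicator_le (S : Set ℕ) (c d : ℕ) :
    ∑ x ∈ Finset.range d, natIndicator S (c + x) ≤ d := by
  simpa using Finset.sum_le_card_nsmul (Finset.range d) (fun x => natIndicator S (c + x)) 1
    (fun x _ => natIndicator_le_one S _)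

lemma sum_natIndicator_shift (S : Set ℕ) (N d : ℕ) :
    ∑ x ∈ Finset.range N, natIndicator S (x + d) ≤
        ∑ x ∈ Finset.range N, natIndicator S x + d ∧
      ∑ x ∈ Finset.range N, natIndicator S x ≤
        ∑ x ∈ Finset.range N, natIndicator S (x + d) + d := by
  have h1 := Finset.sum_range_add (natIndicator S) N d
  have h2 := Finset.sum_range_add (natIndicator S) d N
  have h3 := sum_natIndicator_le S N d
  have h4 := sum_natIndicator_le S 0 d
  simp only [zero_add] at h4
  simp only [add_comm d] at h2
  omega

lemma mul_countBelow_le {S : Set ℕ} {a L K : ℕ}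
    (h : ∀ x, ∑ j ∈ Finset.range L, natIndicator S (x + j * a) ≤ K) (N : ℕ) :
    L * countBelow S N ≤ (N + 1) * K + L * (L * a) := by
  calc L * countBelow S N = ∑ _j ∈ Finset.range L, countBelow S N := by simp
    _ ≤ ∑ j ∈ Finset.range L,
        (∑ x ∈ Finset.range (N + 1), natIndicator S (x + j * a) + L * a) := by
      refine Finset.sum_le_sum fun j hj => ?_
      rw [countBelow_eq_sum]
      refine (sum_natIndicator_shift S (N + 1) (j * a)).2.trans ?_
      have := (Finset.mem_range.1 hj).le
      gcongr
    _ = ∑ x ∈ Finset.range (N + 1), ∑ j ∈ Finset.range L, natIndicator S (x + j * a)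
        + L * (L * a) := by
      rw [Finset.sum_add_distrib, Finset.sum_comm]
      simp
    _ ≤ _ := by
      gcongr
      simpa using Finset.sum_le_card_nsmul (Finset.range (N + 1)) _ K (fun x _ => h x)

lemma le_mul_countBelow {S : Set ℕ} {a L K : ℕ}
    (h : ∀ x, K ≤ ∑ j ∈ Finset.range L, natIndicator S (x + j * a)) (N : ℕ) :
    (N + 1) * K ≤ L * countBelow S N + L * (L * a) := by
  calc (N + 1) * K
      ≤ ∑ x ∈ Finset.range (N + 1), ∑ j ∈ Finset.range L, natIndicator S (x + j * a) := by
        simpa using Finset.card_nsmul_le_sum (Finset.range (N + 1)) _ K (fun x _ => h x)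
    _ = ∑ j ∈ Finset.range L, ∑ x ∈ Finset.range (N + 1), natIndicator S (x + j * a) :=
      Finset.sum_comm
    _ ≤ ∑ _j ∈ Finset.range L, (countBelow S N + L * a) := by
      refine Finset.sum_le_sum fun j hj => ?_
      rw [countBelow_eq_sum]
      refine (sum_natIndicator_shift S (N + 1) (j * a)).1.trans ?_
      have := (Finset.mem_range.1 hj).le
      gcongr
    _ = _ := by simp [mul_add]

lemma countBelow_div_le_s1 {S : Set ℕ} {a L K : ℕ} (hL : 0 < L)
    (h : ∀ x, ∑ j ∈ Finset.range L, natIndicator S (x + j * a) ≤ K) :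
    ∀ᶠ N : ℕ in atTop, (countBelow S N : ℝ) / N ≤ (K : ℝ) / L + (K / L + L * a) / N := by
  filter_upwards [eventually_gt_atTop 0] with N hN
  have h1 : ((L * countBelow S N : ℕ) : ℝ) ≤ (((N + 1) * K + L * (L * a) : ℕ) : ℝ) :=
    Nat.cast_le.2 (mul_countBelow_le h N)
  push_cast at h1
  have hN' : (0 : ℝ) < N := Nat.cast_pos.2 hN
  have hL' : (0 : ℝ) < L := Nat.cast_pos.2 hL
  rw [div_le_iff₀ hN']
  refine le_of_mul_le_mul_left (h1.trans_eq ?_) hL'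
  field_simp
  ring

lemma le_countBelow_div {S : Set ℕ} {a L K : ℕ} (hL : 0 < L)
    (h : ∀ x, K ≤ ∑ j ∈ Finset.range L, natIndicator S (x + j * a)) :
    ∀ᶠ N : ℕ in atTop, (K : ℝ) / L + (K / L - L * a) / N ≤ (countBelow S N : ℝ) / N := by
  filter_upwards [eventually_gt_atTop 0] with N hN
  have h1 : (((N + 1) * K : ℕ) : ℝ) ≤ ((L * countBelow S N + L * (L * a) : ℕ) : ℝ) :=
    Nat.cast_le.2 (le_mul_countBelow h N)
  push_cast at h1
  have hN' : (0 : ℝ) < N := Nat.cast_pos.2 hN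
  have hL' : (0 : ℝ) < L := Nat.cast_pos.2 hL
  rw [le_div_iff₀ hN']
  refine le_of_mul_le_mul_left (le_trans (le_of_eq ?_) (sub_le_iff_le_add.2 h1)) hL'
  field_simp
  ring

lemma tendsto_const_add_div_natCast (c d : ℝ) :
    Tendsto (fun N : ℕ => c + d / N) atTop (nhds c) := by
  simpa using tendsto_const_nhds.add (tendsto_const_div_atTop_nhds_zero_nat d)

lemma upperDensity_le_s1 {S : Set ℕ} {a L K : ℕ} (hL : 0 < L)
    (h : ∀ x, ∑ j ∈ Finset.range L, natIndicator S (x + j * a) ≤ K) :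
    upperDensity S ≤ (K : ℝ) / L := by
  have ht := tendsto_const_add_div_natCast ((K : ℝ) / L) (K / L + L * a)
  rw [← ht.limsup_eq]
  refine limsup_le_limsup (countBelow_div_le_s1 hL h) ?_ ht.isBoundedUnder_le
  exact (isBoundedUnder_of ⟨0, fun N => by positivity⟩ :
    IsBoundedUnder (· ≥ ·) atTop _).isCoboundedUnder_le

lemma upperDensity_eq {S : Set ℕ} {a L K : ℕ} (hL : 0 < L)
    (h : ∀ x, ∑ j ∈ Finset.range L, natIndicator S (x + j * a) = K) :
    upperDensity S = (K : ℝ) / L :=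
  (tendsto_of_tendsto_of_tendsto_of_le_of_le'
    (tendsto_const_add_div_natCast _ _) (tendsto_const_add_div_natCast _ _)
    (le_countBelow_div hL fun x => (h x).ge) (countBelow_div_le_s1 hL fun x => (h x).le)).limsup_eq

/-- An independent set of a cycle of length `q + 1` has at most `(q + 1) / 2` elements. -/
lemma sum_range_le_of_cycle {f : ℕ → ℕ} {q : ℕ} (h : ∀ j < q, f j + f (j + 1) ≤ 1)
    (h' : f 0 + f q ≤ 1) : ∑ j ∈ Finset.range (q + 1), f j ≤ (q + 1) / 2 := by
  have h1 : ∑ j ∈ Finset.range q, (f j + f (j + 1)) ≤ q := by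
    simpa using Finset.sum_le_card_nsmul (Finset.range q) _ 1
      (fun j hj => h j (Finset.mem_range.1 hj))
  rw [Finset.sum_add_distrib] at h1
  have h2 := Finset.sum_range_succ f q
  have h3 := Finset.sum_range_succ' f q
  omega

lemma IsMSet.natIndicator_add_le {M S : Set ℕ} (hS : IsMSet M S) {m : ℕ} (hm : m ∈ M) (x : ℕ) :
    natIndicator S x + natIndicator S (x + m) ≤ 1 := by
  unfold natIndicator
  split_ifs with h1 h2
  · exact absurd (by simpa using hm) (hS _ h2 _ h1)
  all_goals simp

lemma IsMSet.sum_natIndicator_le {M S : Set ℕ} (hS : IsMSet M S) {a q : ℕ} (h1 : a ∈ M)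
    (hq : a * q ∈ M) (x : ℕ) :
    ∑ j ∈ Finset.range (q + 1), natIndicator S (x + j * a) ≤ (q + 1) / 2 := by
  refine sum_range_le_of_cycle (f := fun j => natIndicator S (x + j * a)) (fun j _ => ?_) ?_
  · simpa [add_mul, add_assoc] using hS.natIndicator_add_le h1 (x + j * a)
  · simpa [mul_comm] using hS.natIndicator_add_le hq x

/-- The naturals `x` for which `x / a` is congruent modulo `q + 1` to one of
`0, 2, 4, …` that is smaller than `q`. -/
def evenResidueSet (a q : ℕ) : Set ℕ :=
  {x | Even (x / a % (q + 1)) ∧ x / a % (q + 1) ≠ q}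

lemma isMSet_evenResidueSet {a q : ℕ} (ha : 0 < a) (hq : 0 < q) :
    IsMSet {m | ∃ k, m = a * q ^ k} (evenResidueSet a q) := by
  rintro x ⟨hx, hxq⟩ y ⟨hy, hyq⟩ ⟨k, hk⟩
  have hpos : 0 < a * q ^ k := by positivity
  obtain rfl : x = y + a * q ^ k := by omega
  rw [Nat.add_mul_div_left _ _ ha] at hx hxq
  generalize y / a = u at *
  have hd : ((q + 1 : ℕ) : ℤ) ∣ ((u + q ^ k) % (q + 1) : ℕ) - (u % (q + 1) : ℕ) - (q : ℤ) ^ k := by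
    have h1 := Int.emod_add_mul_ediv (u + (q : ℤ) ^ k) (q + 1)
    have h2 := Int.emod_add_mul_ediv (u : ℤ) (q + 1)
    push_cast
    exact ⟨u / (q + 1) - (u + (q : ℤ) ^ k) / (q + 1), by linear_combination h1 - h2⟩
  have hr := Nat.mod_lt (u + q ^ k) q.succ_pos
  have hs := Nat.mod_lt u q.succ_pos
  have hp : ((q + 1 : ℕ) : ℤ) ∣ (q : ℤ) ^ k - (-1) ^ k := by
    simpa using sub_dvd_pow_sub_pow (q : ℤ) (-1) k
  have hd' := dvd_add hd hp
  rw [sub_add_sub_cancel] at hd'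
  simp only [Nat.succ_eq_add_one] at hr hs
  generalize (u + q ^ k) % (q + 1) = r at *
  generalize u % (q + 1) = s at *
  obtain ⟨r, rfl⟩ := hx
  obtain ⟨s, rfl⟩ := hy
  have key := Int.eq_zero_of_abs_lt_dvd hd'
  rcases neg_one_pow_eq_or ℤ k with h | h <;> rw [h] at key
  all_goals
    have := key (by rw [abs_lt]; constructor <;> push_cast <;> omega)
    omega

lemma sum_evenResidueSet {a q : ℕ} (ha : 0 < a) (x : ℕ) :
    (q + 1) / 2 ≤ ∑ j ∈ Finset.range (q + 1), natIndicator (evenResidueSet a q) (x + j * a) := by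
  classical
  have hper : Function.Periodic
      (fun r : ℕ => Even (r % (q + 1)) ∧ r % (q + 1) ≠ q) (q + 1) := fun r => by simp
  have h1 := Nat.filter_Ico_card_eq_of_periodic (x / a) (q + 1) _ hper
  have h2 : ∑ j ∈ Finset.range (q + 1), natIndicator (evenResidueSet a q) (x + j * a) =
      ((Finset.Ico (x / a) (x / a + (q + 1))).filter
        fun r : ℕ => Even (r % (q + 1)) ∧ r % (q + 1) ≠ q).card := by
    rw [Finset.card_filter, Finset.sum_Ico_eq_sum_range, Nat.add_sub_cancel_left]
    refine Finset.sum_congr rfl fun j _ => ?_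
    simp [natIndicator, evenResidueSet, Nat.add_mul_div_right _ _ ha]
  rw [h2, h1, Nat.count_eq_card_filter_range]
  calc (q + 1) / 2 = ((Finset.range ((q + 1) / 2)).image (2 * ·)).card := by
        rw [Finset.card_image_of_injective _ fun i j h => by simpa using h, Finset.card_range]
    _ ≤ _ := by
      refine Finset.card_le_card fun r hr => ?_
      obtain ⟨i, hi, rfl⟩ := Finset.mem_image.1 hr
      rw [Finset.mem_range] at hi
      have hlt : 2 * i < q + 1 := by omega
      rw [Finset.mem_filter, Finset.mem_range, Nat.mod_eq_of_lt hlt]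
      exact ⟨hlt, even_two_mul i, by omega⟩

lemma muM_geometric_progression {a q n : ℕ} (ha : 0 < a) (hq : 0 < q) (hn : 0 < n) :
    muM {m | ∃ k ≤ n, m = a * q ^ k} = (((q + 1) / 2 : ℕ) : ℝ) / ((q + 1 : ℕ) : ℝ) := by
  have hub : ∀ S, IsMSet {m | ∃ k ≤ n, m = a * q ^ k} S → ∀ x,
      ∑ j ∈ Finset.range (q + 1), natIndicator S (x + j * a) ≤ (q + 1) / 2 := fun S hS =>
    hS.sum_natIndicator_le ⟨0, hn.le, by simp⟩ ⟨1, hn, by simp⟩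
  have hset : IsMSet {m | ∃ k ≤ n, m = a * q ^ k} (evenResidueSet a q) :=
    fun x hx y hy ⟨k, _, hk⟩ => isMSet_evenResidueSet ha hq x hx y hy ⟨k, hk⟩
  refine IsGreatest.csSup_eq ⟨⟨evenResidueSet a q, hset, ?_⟩, ?_⟩
  · exact (upperDensity_eq q.succ_pos fun x =>
      (hub _ hset x).antisymm (sum_evenResidueSet ha x)).symm
  · rintro _ ⟨S, hS, rfl⟩
    exact upperDensity_le_s1 q.succ_pos (hub S hS)

/-- Corollary 1: If `M = {a, aq, aq², …, aqⁿ}` is a finite geometric progression with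
`q ≥ 2`, then `μ(M) = 1/2` if `q` is odd and `μ(M) = q/(2(q+1))` if `q` is even. -/
theorem stmt1 (a q n : ℕ) (ha : 0 < a) (hq : 2 ≤ q) (hn : 0 < n)
    (M : Set ℕ) (hM : M = {m | ∃ k ≤ n, m = a * q ^ k}) :
    (Odd q → muM M = 1 / 2) ∧
    (Even q → muM M = (q : ℝ) / (2 * ((q : ℝ) + 1))) := by
  rw [hM, muM_geometric_progression ha (by omega) hn]
  constructor
  · rintro ⟨m, rfl⟩
    rw [show (2 * m + 1 + 1) / 2 = m + 1 by omega]
    push_cast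
    rw [div_eq_div_iff (by positivity) (by positivity)]
    ring
  · rintro ⟨m, rfl⟩
    rw [show (m + m + 1) / 2 = m by omega]
    push_cast
    rw [div_eq_div_iff (by positivity) (by positivity)]
    ring
end

section
/- Let M = {m₁, m₂, …, mₙ} be a set of positive integers with m₁ < m₂ < … < mₙ such that m_j − m_i ∈ M for all 2 ≤ i < j ≤ n. Then for every finite M-set S of nonnegative integers, |S + M| ≥ (n−1)|S|, where S + M = {s + m : s ∈ S, m ∈ M}. -/
open Filter Set Pointwise

/-- If `M = {m₁ < m₂ < ⋯ < mₙ}` satisfies `m_j - m_i ∈ M` for all `2 ≤ i < j ≤ n`,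
then every finite `M`-set `S` satisfies `|S + M| ≥ (n-1)|S|`. -/
theorem stmt3 (n : ℕ) (hn : 0 < n) (m : Fin n → ℕ)
    (hpos : ∀ k, 0 < m k) (hmono : StrictMono m)
    (hdiff : ∀ p q : Fin n, 0 < (p : ℕ) → p < q → m q - m p ∈ Set.range m)
    (M : Finset ℕ) (hM : (M : Set ℕ) = Set.range m)
    (S : Finset ℕ) (hS : IsMSet ↑M ↑S) :
    (n - 1) * S.card ≤ (S + M).card := by
  have separated : ∀ p q : Fin n, 0 < (p : ℕ) → p < q →
      ∀ s ∈ S, ∀ t ∈ S, s + m p ≠ t + m q := by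
    intro p q hp hpq s hs t ht h
    apply hS s hs t ht
    have hlt := hmono hpq
    rw [show s - t = m q - m p by omega, hM]
    exact hdiff p q hp hpq
  let I : Finset (Fin n) := Finset.univ.erase ⟨0, hn⟩
  have hI : ∀ p ∈ I, 0 < (p : ℕ) := by
    intro p hp
    have hne := Finset.ne_of_mem_erase hp
    exact Nat.pos_of_ne_zero fun h => hne (Fin.ext h)
  have hcard : (I ×ˢ S).card = (n - 1) * S.card := by
    simp [I, Finset.card_product]
  rw [← hcard]
  refine Finset.card_le_card_of_injOn (fun x => x.2 + m x.1) ?_ ?_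
  · rintro ⟨p, s⟩ hx
    have hs : s ∈ S := (Finset.mem_product.mp hx).2
    have hp : m p ∈ M := by
      rw [← Finset.mem_coe, hM]
      exact Set.mem_range_self p
    exact Finset.add_mem_add hs hp
  · rintro ⟨p, s⟩ hx ⟨q, t⟩ hy h
    obtain ⟨hp, hs⟩ := Finset.mem_product.mp hx
    obtain ⟨hq, ht⟩ := Finset.mem_product.mp hy
    rcases lt_trichotomy p q with hpq | rfl | hqp
    · exact (separated p q (hI p hp) hpq s hs t ht h).elim
    · exact Prod.ext rfl (Nat.add_right_cancel h)
    · exact (separated q p (hI q hq) hqp t ht s hs h.symm).elim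
end

section
/- Let M = {m₁, m₂, …, mₙ} be a set of positive integers with m₁ < m₂ < … < mₙ such that m_j − m_i ∈ M for all 2 ≤ i < j ≤ n. Then for every positive integer x and every M-set S ⊆ [0, x], we have |S| ≤ (x + mₙ + 1)/n. -/
open Filter Set Pointwise

/-- If `M = {m₁ < m₂ < ⋯ < mₙ}` satisfies `m_j - m_i ∈ M` for all `2 ≤ i < j ≤ n`,
then every `M`-set `S ⊆ [0, x]` satisfies `|S| ≤ (x + mₙ + 1)/n`. -/
theorem stmt4 (n : ℕ) (hn : 0 < n) (m : Fin n → ℕ)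
    (hpos : ∀ k, 0 < m k) (hmono : StrictMono m)
    (hdiff : ∀ p q : Fin n, 0 < (p : ℕ) → p < q → m q - m p ∈ Set.range m)
    (x : ℕ) (hx : 0 < x) (S : Finset ℕ) (hSx : ∀ s ∈ S, s ≤ x)
    (hS : IsMSet (Set.range m) ↑S) :
    (S.card : ℝ) ≤ ((x : ℝ) + (m ⟨n - 1, by omega⟩ : ℝ) + 1) / (n : ℝ) := by
  classical
  let d : Fin n → ℕ := fun k => if (k : ℕ) = 0 then 0 else m k
  have hd_le : ∀ k, d k ≤ m ⟨n - 1, by omega⟩ := by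
    intro k
    by_cases hk : (k : ℕ) = 0
    · simp [d, hk]
    · simp only [d, hk, if_false]
      exact hmono.monotone (Fin.le_def.2 (by have := k.isLt; simp only; omega))
  have hd_diff : ∀ p q : Fin n, p < q → d p < d q ∧ d q - d p ∈ Set.range m := by
    intro p q hpq
    have hq : (q : ℕ) ≠ 0 := by have := Fin.lt_def.1 hpq; omega
    by_cases hp : (p : ℕ) = 0
    · simp only [d, hp, hq, if_true, if_false]
      exact ⟨hpos q, q, by simp⟩
    · simp only [d, hp, hq, if_false]
      exact ⟨hmono hpq, hdiff p q (Nat.pos_of_ne_zero hp) hpq⟩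
  have hne : ∀ s ∈ S, ∀ t ∈ S, ∀ p q : Fin n, p < q → s + d p ≠ t + d q := by
    intro s hs t ht p q hpq h
    obtain ⟨hlt, hmem⟩ := hd_diff p q hpq
    refine hS s hs t ht ?_
    rwa [show s - t = d q - d p by omega]
  have hcard : (S ×ˢ (Finset.univ : Finset (Fin n))).card ≤
      (Finset.range (x + m ⟨n - 1, by omega⟩ + 1)).card := by
    refine Finset.card_le_card_of_injOn (fun z => z.1 + d z.2) ?_ ?_
    · intro z hz
      have hz1 := hSx z.1 (Finset.mem_product.1 hz).1
      have := hd_le z.2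
      simp only [Finset.coe_range, Set.mem_Iio]
      omega
    · rintro ⟨s, p⟩ hs ⟨t, q⟩ ht h
      have hs' : s ∈ S := (Finset.mem_product.1 hs).1
      have ht' : t ∈ S := (Finset.mem_product.1 ht).1
      simp only at h
      rcases lt_trichotomy p q with hpq | rfl | hpq
      · exact absurd h (hne s hs' t ht' p q hpq)
      · rw [Nat.add_right_cancel h]
      · exact absurd h.symm (hne t ht' s hs' q p hpq)
  rw [Finset.card_product, Finset.card_univ, Fintype.card_fin, Finset.card_range] at hcard
  rw [le_div_iff₀ (by exact_mod_cast hn)]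
  exact_mod_cast hcard
end

section
/- Let M = {m₁, m₂, …, mₙ} be a set of positive integers with m₁ < m₂ < … < mₙ such that m_j − m_i ∈ M for all 2 ≤ i < j ≤ n. Then μ(M) ≤ 1/n. -/
open Filter Set Pointwise

/-- If the translates of `S` by `n` shifts `d k ≤ C` are pairwise disjoint, then
`n * S(x) ≤ x + C + 1`. -/
lemma mul_countBelow_le_s5 {n C : ℕ} {S : Set ℕ} (d : Fin n → ℕ) (hC : ∀ k, d k ≤ C)
    (hd : ∀ p q : Fin n, p < q → ∀ a ∈ S, ∀ b ∈ S, a + d p ≠ b + d q) (x : ℕ) :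
    n * countBelow S x ≤ x + C + 1 := by
  have hfin : (S ∩ Set.Iic x).Finite := (Set.finite_Iic x).inter_of_right S
  have hcard := Finset.card_le_card_of_injOn (s := Finset.univ ×ˢ hfin.toFinset)
    (t := Finset.range (x + C + 1)) (fun y : Fin n × ℕ => y.2 + d y.1) ?_ ?_
  · rwa [Finset.card_product, Finset.card_univ, Fintype.card_fin, Finset.card_range,
      ← Set.ncard_eq_toFinset_card _ hfin] at hcard
  · rintro ⟨k, a⟩ h
    have ha : a ∈ S ∧ a ≤ x := by simpa using h
    have := hC k
    simp only [Finset.coe_range, Set.mem_Iio]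
    omega
  · rintro ⟨k, a⟩ h ⟨l, b⟩ h' heq
    have ha : a ∈ S ∧ a ≤ x := by simpa using h
    have hb : b ∈ S ∧ b ≤ x := by simpa using h'
    simp only at heq
    rcases lt_trichotomy k l with hkl | rfl | hkl
    · exact absurd heq (hd k l hkl a ha.1 b hb.1)
    · simpa using heq
    · exact absurd heq.symm (hd l k hkl b hb.1 a ha.1)

lemma upperDensity_le_of_mul_countBelow_le {n C : ℕ} (hn : 0 < n) {S : Set ℕ}
    (h : ∀ x, n * countBelow S x ≤ x + C) : upperDensity S ≤ 1 / (n : ℝ) := by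
  have hlim : Tendsto (fun x : ℕ => 1 / (n : ℝ) * (1 + (C : ℝ) / x)) atTop (nhds (1 / (n : ℝ))) := by
    simpa using ((tendsto_const_div_atTop_nhds_zero_nat (C : ℝ)).const_add 1).const_mul
      (1 / (n : ℝ))
  rw [← hlim.limsup_eq]
  refine limsup_le_limsup ?_ ?_ hlim.isBoundedUnder_le
  · filter_upwards [eventually_gt_atTop 0] with x hx
    have hx' : (0 : ℝ) < x := by exact_mod_cast hx
    have hn' : (0 : ℝ) < n := by exact_mod_cast hn
    have hh : (n : ℝ) * countBelow S x ≤ x + C := by exact_mod_cast h x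
    have e : 1 / (n : ℝ) * (1 + (C : ℝ) / x) = (x + C) / n / x := by field_simp
    rw [e]
    gcongr
    rwa [le_div_iff₀ hn', mul_comm]
  · exact IsBoundedUnder.isCoboundedUnder_le ⟨0, eventually_map.2 (.of_forall fun x => by positivity)⟩

/-- If `M = {m₁ < m₂ < ⋯ < mₙ}` satisfies `m_j - m_i ∈ M` for all `2 ≤ i < j ≤ n`,
then `μ(M) ≤ 1/n`. -/
theorem stmt5 (n : ℕ) (hn : 0 < n) (m : Fin n → ℕ)
    (hpos : ∀ k, 0 < m k) (hmono : StrictMono m)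
    (hdiff : ∀ p q : Fin n, 0 < (p : ℕ) → p < q → m q - m p ∈ Set.range m) :
    muM (Set.range m) ≤ 1 / (n : ℝ) := by
  refine Real.sSup_le ?_ (by positivity)
  rintro _ ⟨S, hS, rfl⟩
  refine upperDensity_le_of_mul_countBelow_le hn (C := (∑ k, m k) + 1) fun x =>
    mul_countBelow_le_s5 (fun k => if (k : ℕ) = 0 then 0 else m k) (fun k => ?_) ?_ x
  · have := Finset.single_le_sum (fun i _ => Nat.zero_le (m i)) (Finset.mem_univ k)
    split_ifs <;> omega
  · intro p q hpq a ha b hb heq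
    have hq : (q : ℕ) ≠ 0 := by have : (p : ℕ) < q := hpq; omega
    have hlt := hmono hpq
    apply hS a ha b hb
    by_cases hp : (p : ℕ) = 0
    · simp only [hp, hq, if_true, if_false] at heq
      exact ⟨q, by omega⟩
    · simp only [hp, hq, if_false] at heq
      have e : a - b = m q - m p := by omega
      exact e ▸ hdiff p q (Nat.pos_of_ne_zero hp) hpq
end

section
/- Let i, j be positive integers with i < j and gcd(i, j) = 1, and let M = {i, j, i + j, i + 2j}. If i + 3j ≡ 0 (mod 4) or i + 3j ≡ 2 (mod 4), then μ(M) = 1/4. -/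
open Filter Set Pointwise

lemma countBelow_eq_card_filter (S : Set ℕ) [DecidablePred (· ∈ S)] (x : ℕ) :
    countBelow S x = ({n ∈ Finset.range (x + 1) | n ∈ S} : Finset ℕ).card := by
  rw [countBelow, ← Set.ncard_coe_finset]
  congr 1
  ext n
  simp [and_comm]

open Finset in
/-- If the translates of `S` by the elements of a finite set `T ⊆ [0, m]` are pairwise disjoint,
then `S` has at most `(x + 1 + m) / |T|` elements up to `x`. -/
lemma card_mul_countBelow_le {S : Set ℕ} {T : Finset ℕ} {m : ℕ} (hT : ∀ t ∈ T, t ≤ m)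
    (h : ∀ a ∈ S, ∀ t ∈ T, ∀ b ∈ S, ∀ u ∈ T, a + t = b + u → a = b) (x : ℕ) :
    #T * countBelow S x ≤ x + 1 + m := by
  classical
  rw [countBelow_eq_card_filter, mul_comm, ← card_product, ← card_range (x + 1 + m)]
  refine card_le_card_of_injOn (fun p => p.1 + p.2) ?_ ?_
  · rintro ⟨a, t⟩ hp
    simp only [coe_product, Set.mem_prod, mem_coe, mem_filter, Finset.mem_range] at hp ⊢
    have := hT t hp.2
    omega
  · rintro ⟨a, t⟩ hp ⟨b, u⟩ hq hpq
    simp only [coe_product, Set.mem_prod, mem_coe, mem_filter, Finset.mem_range] at hp hq hpq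
    obtain rfl := h a hp.1.2 t hp.2 b hq.1.2 u hq.2 hpq
    simpa using hpq

open Finset in
/-- If every natural number is a sum of an element of `S` and an element of a finite set `T`,
then `S` has at least `(x + 1) / |T|` elements up to `x`. -/
lemma le_card_mul_countBelow {S : Set ℕ} {T : Finset ℕ}
    (h : ∀ n, ∃ s ∈ S, ∃ t ∈ T, s + t = n) (x : ℕ) :
    x + 1 ≤ #T * countBelow S x := by
  classical
  rw [countBelow_eq_card_filter, mul_comm, ← card_product]
  calc x + 1 = #(range (x + 1)) := (card_range _).symm
    _ ≤ #(image (fun p : ℕ × ℕ => p.1 + p.2) ({n ∈ range (x + 1) | n ∈ S} ×ˢ T)) := by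
      refine card_le_card fun n hn => ?_
      obtain ⟨s, hs, t, ht, rfl⟩ := h n
      rw [Finset.mem_range] at hn
      refine mem_image.2 ⟨(s, t), ?_, rfl⟩
      simp only [mem_product, mem_filter, Finset.mem_range]
      exact ⟨⟨by omega, hs⟩, ht⟩
    _ ≤ _ := card_image_le

lemma countBelow_div_nonneg (S : Set ℕ) (x : ℕ) : 0 ≤ (countBelow S x : ℝ) / x := by
  positivity

lemma tendsto_one_div_add_div (k C : ℝ) :
    Tendsto (fun x : ℕ => 1 / k + C / x) atTop (nhds (1 / k)) := by
  simpa using tendsto_const_nhds.add (tendsto_const_div_atTop_nhds_zero_nat C)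

lemma eventually_countBelow_div_le {S : Set ℕ} {k C : ℕ} (hk : 0 < k)
    (h : ∀ x, k * countBelow S x ≤ x + C) :
    ∀ᶠ x : ℕ in atTop, (countBelow S x : ℝ) / x ≤ 1 / (k : ℝ) + (C / k : ℝ) / x := by
  filter_upwards [eventually_gt_atTop 0] with x hx
  have hx' : (0 : ℝ) < x := by exact_mod_cast hx
  have hk' : (0 : ℝ) < k := by exact_mod_cast hk
  have h' : (k : ℝ) * countBelow S x ≤ x + C := by exact_mod_cast h x
  rw [div_le_iff₀ hx']
  have : (1 / (k : ℝ) + (C / k : ℝ) / x) * x = (x + C) / k := by field_simp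
  rw [this, le_div_iff₀ hk']
  linarith

lemma upperDensity_le_s8 {S : Set ℕ} {k C : ℕ} (hk : 0 < k)
    (h : ∀ x, k * countBelow S x ≤ x + C) : upperDensity S ≤ 1 / k := by
  have ht := tendsto_one_div_add_div (k : ℝ) (C / k : ℝ)
  rw [← ht.limsup_eq]
  exact limsup_le_limsup (eventually_countBelow_div_le hk h)
    (isCoboundedUnder_le_of_le atTop (countBelow_div_nonneg S)) ht.isBoundedUnder_le

lemma le_upperDensity_s8 {S : Set ℕ} {k C : ℕ} (hk : 0 < k)
    (h : ∀ x, k * countBelow S x ≤ x + C) (h' : ∀ x, x ≤ k * countBelow S x) :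
    1 / k ≤ upperDensity S := by
  refine le_limsup_of_frequently_le (Eventually.frequently ?_)
    ((tendsto_one_div_add_div (k : ℝ) (C / k : ℝ)).isBoundedUnder_le.mono_le
      (eventually_countBelow_div_le hk h))
  filter_upwards [eventually_gt_atTop 0] with x hx
  have hx' : (0 : ℝ) < x := by exact_mod_cast hx
  have hk' : (0 : ℝ) < k := by exact_mod_cast hk
  have := h' x
  rw [div_le_div_iff₀ hk' hx', one_mul, mul_comm]
  exact_mod_cast this

lemma IsMSet.four_mul_countBelow_le {i j : ℕ} (hi : 0 < i) (hj : 0 < j) {S : Set ℕ}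
    (hS : IsMSet {i, j, i + j, i + 2 * j} S) (x : ℕ) :
    4 * countBelow S x ≤ x + (1 + (i + 2 * j)) := by
  have hcard : ({0, j, i + j, i + 2 * j} : Finset ℕ).card = 4 := by
    rw [Finset.card_insert_of_notMem, Finset.card_insert_of_notMem,
      Finset.card_insert_of_notMem, Finset.card_singleton] <;>
    simp only [Finset.mem_insert, Finset.mem_singleton] <;> omega
  rw [← hcard, ← add_assoc]
  refine card_mul_countBelow_le (fun t ht => ?_) (fun a ha t ht b hb u hu hab => ?_) x
  · simp only [Finset.mem_insert, Finset.mem_singleton] at ht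
    omega
  · have h₁ := hS a ha b hb
    have h₂ := hS b hb a ha
    simp only [Finset.mem_insert, Finset.mem_singleton] at ht hu
    simp only [Set.mem_insert_iff, Set.mem_singleton_iff] at h₁ h₂
    omega

/-- For odd `i` and `j` with `i + j = 2 q r`, `r` odd, the set of even `n` with `⌊n / (2 q)⌋` even
is an `{i, j, i + j, i + 2 j}`-set. -/
lemma isMSet_even_div_even {i j q m : ℕ} (hi : i % 2 = 1) (hj : j % 2 = 1) (hq : 0 < q)
    (h : i + j = 2 * (q * (2 * m + 1))) :
    IsMSet {i, j, i + j, i + 2 * j} {n | n % 2 = 0 ∧ n / 2 / q % 2 = 0} := by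
  rintro a ⟨ha, ha'⟩ b ⟨hb, hb'⟩ hab
  simp only [Set.mem_insert_iff, Set.mem_singleton_iff] at hab
  have hsum : a = b + 2 * (q * (2 * m + 1)) := by omega
  have hhalf : a / 2 = b / 2 + q * (2 * m + 1) := by omega
  rw [hhalf, Nat.add_mul_div_left _ _ hq] at ha'
  omega

lemma exists_add_eq_of_even_div_even {q : ℕ} (hq : 0 < q) (n : ℕ) :
    ∃ s ∈ {n | n % 2 = 0 ∧ n / 2 / q % 2 = 0},
      ∃ t ∈ ({0, 1, 2 * q, 2 * q + 1} : Finset ℕ), s + t = n := by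
  have hn : q * (n / 2 / q) + n / 2 % q = n / 2 := Nat.div_add_mod _ _
  have hlt : n / 2 % q < q := Nat.mod_lt _ hq
  set v := n / 2 / q
  set w := n / 2 % q
  have hv : q * v = q * (2 * (v / 2)) + q * (v % 2) := by rw [← mul_add, Nat.div_add_mod]
  refine ⟨2 * (w + q * (2 * (v / 2))), ⟨by omega, ?_⟩, 2 * (q * (v % 2)) + n % 2, ?_, by omega⟩
  · rw [Nat.mul_div_cancel_left _ two_pos, Nat.add_mul_div_left _ _ hq, Nat.div_eq_of_lt hlt]
    omega
  · simp only [Finset.mem_insert, Finset.mem_singleton]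
    rcases Nat.mod_two_eq_zero_or_one v with hv | hv <;> rw [hv] <;> omega

/-- Corollary 2 (equality cases): For `M = {i, j, i+j, i+2j}` with `i < j`, `gcd(i,j) = 1`,
if `i + 3j ≡ 0` or `2 (mod 4)` then `μ(M) = 1/4`. -/
theorem stmt8 (i j : ℕ) (hi : 0 < i) (hij : i < j) (hgcd : Nat.gcd i j = 1)
    (M : Set ℕ) (hM : M = {i, j, i + j, i + 2 * j})
    (hres : (i + 3 * j) % 4 = 0 ∨ (i + 3 * j) % 4 = 2) :
    muM M = 1 / 4 := by
  subst hM
  have hodd : i % 2 = 1 ∧ j % 2 = 1 := by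
    by_contra hne
    have : 2 ∣ Nat.gcd i j := Nat.dvd_gcd (by omega) (by omega)
    omega
  have hj : 0 < j := by omega
  obtain ⟨e, r, ⟨m, rfl⟩, hr⟩ := Nat.exists_eq_two_pow_mul_odd (n := (i + j) / 2) (by omega)
  have hq : 0 < 2 ^ e := by positivity
  have hS := isMSet_even_div_even hodd.1 hodd.2 hq (m := m) (by omega)
  have hupper {S : Set ℕ} (hS : IsMSet {i, j, i + j, i + 2 * j} S) : upperDensity S ≤ 1 / 4 := by
    exact_mod_cast upperDensity_le_s8 four_pos (hS.four_mul_countBelow_le hi hj)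
  refine IsGreatest.csSup_eq ⟨⟨_, hS, le_antisymm ?_ (hupper hS)⟩, ?_⟩
  · have hlower := le_upperDensity_s8 four_pos (hS.four_mul_countBelow_le hi hj) fun x =>
      (Nat.le_succ x).trans <| (le_card_mul_countBelow (exists_add_eq_of_even_div_even hq) x).trans
        (Nat.mul_le_mul_right _ Finset.card_le_four)
    exact_mod_cast hlower
  · rintro _ ⟨S, hS, rfl⟩
    exact hupper hS
end

section
/- Let i, j, n be positive integers with n ≥ 1 and gcd(i, j) = 1, let M = {i + k₁j : 0 ≤ k₁ ≤ n−1} ∪ {k₂j : 1 ≤ k₂ ≤ n}, and suppose i + nj ≡ 1 (mod n+1). Set t = i + nj. Then every M-set S with 0 ∈ S satisfies S(t−1) ≤ (t−1)/(n+1), i.e., S contains at most (t−1)/(n+1) elements in the interval [0, t−1]. -/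
open Filter Set Pointwise

/-- If no difference of two elements of `A ⊆ [0, t)` is of the form `d * j` or `t - d * j` with
`1 ≤ d ≤ n`, then the translates `A + k * j` with `k ≤ n` are disjoint modulo `t`. -/
theorem card_mul_succ_le_of_sub_ne {n j t : ℕ} (hjt : n * j < t) {A : Finset ℕ}
    (hA : ∀ a ∈ A, a < t)
    (h₁ : ∀ a ∈ A, ∀ b ∈ A, ∀ d, 1 ≤ d → d ≤ n → a - b ≠ d * j)
    (h₂ : ∀ a ∈ A, ∀ b ∈ A, ∀ d, 1 ≤ d → d ≤ n → a - b ≠ t - d * j) :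
    A.card * (n + 1) ≤ t := by
  have inj : ∀ a ∈ A, ∀ b ∈ A, ∀ k l, k ≤ l → l ≤ n →
      (a + k * j) % t = (b + l * j) % t → a = b ∧ k = l := by
    intro a ha b hb k l hkl hln h
    obtain ⟨d, rfl⟩ := Nat.exists_eq_add_of_le hkl
    have hmod : a ≡ b + d * j [MOD t] := by
      refine Nat.ModEq.add_right_cancel' (k * j) (h.trans ?_)
      rw [add_mul, add_assoc, add_comm (d * j)]
    have hdj : d * j < t := (Nat.mul_le_mul_right j (by omega)).trans_lt hjt
    have hat := hA a ha
    have hbt := hA b hb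
    rw [Nat.ModEq, Nat.mod_eq_of_lt hat] at hmod
    rcases Nat.eq_zero_or_pos d with rfl | hd
    · rw [zero_mul, add_zero, Nat.mod_eq_of_lt hbt] at hmod
      exact ⟨hmod, rfl⟩
    · exfalso
      rcases lt_or_ge (b + d * j) t with hlt | hge
      · rw [Nat.mod_eq_of_lt hlt] at hmod
        exact h₁ a ha b hb d hd (by omega) (by omega)
      · rw [Nat.mod_eq_sub_mod hge, Nat.mod_eq_of_lt (by omega)] at hmod
        exact h₂ b hb a ha d hd (by omega) (by omega)
  have hcard : (A ×ˢ Finset.range (n + 1)).card ≤ (Finset.range t).card := by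
    refine Finset.card_le_card_of_injOn (fun p => (p.1 + p.2 * j) % t) ?_ ?_
    · intro p _
      simpa using Nat.mod_lt _ (by omega)
    · rintro ⟨a, k⟩ hp ⟨b, l⟩ hq h
      simp only [Finset.coe_product, Set.mem_prod, Finset.mem_coe, Finset.mem_range] at hp hq
      rcases le_total k l with hkl | hlk
      · obtain ⟨rfl, rfl⟩ := inj a hp.1 b hq.1 k l hkl (by omega) h
        rfl
      · obtain ⟨rfl, rfl⟩ := inj b hq.1 a hp.1 l k hlk (by omega) h.symm
        rfl
  simpa using hcard

/-- Upper-bound step in the proof of Theorem 4: with `t = i + nj`, every `M`-set `S`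
containing `0` has at most `(t-1)/(n+1)` elements in `[0, t-1]`. -/
theorem stmt11 (i j n : ℕ) (hi : 0 < i) (hj : 0 < j) (hn : 0 < n)
    (hgcd : Nat.gcd i j = 1)
    (M : Set ℕ)
    (hM : M = {m | ∃ k < n, m = i + k * j} ∪ {m | ∃ k, 1 ≤ k ∧ k ≤ n ∧ m = k * j})
    (hres : (i + n * j) % (n + 1) = 1)
    (t : ℕ) (ht : t = i + n * j)
    (S : Set ℕ) (hS : IsMSet M S) (h0 : 0 ∈ S) :
    (countBelow S (t - 1) : ℝ) ≤ ((t : ℝ) - 1) / ((n : ℝ) + 1) := by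
  have hfin : (S ∩ Set.Iic (t - 1)).Finite := (Set.finite_Iic _).subset Set.inter_subset_right
  have hcard : countBelow S (t - 1) * (n + 1) ≤ t := by
    rw [countBelow, Set.ncard_eq_toFinset_card _ hfin]
    refine card_mul_succ_le_of_sub_ne (j := j) (by omega) ?_ ?_ ?_
    · intro a ha
      have := ((Set.Finite.mem_toFinset _).1 ha).2
      rw [Set.mem_Iic] at this
      omega
    · intro a ha b hb d hd hdn h
      refine hS a ((Set.Finite.mem_toFinset _).1 ha).1 b ((Set.Finite.mem_toFinset _).1 hb).1 ?_
      rw [hM]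
      exact Or.inr ⟨d, hd, hdn, h⟩
    · intro a ha b hb d hd hdn h
      refine hS a ((Set.Finite.mem_toFinset _).1 ha).1 b ((Set.Finite.mem_toFinset _).1 hb).1 ?_
      rw [hM]
      refine Or.inl ⟨n - d, by omega, ?_⟩
      have := Nat.mul_le_mul_right j hdn
      rw [h, ht, Nat.sub_mul]
      omega
  have hlt : countBelow S (t - 1) * (n + 1) + 1 ≤ t := by
    refine Nat.succ_le_of_lt (lt_of_le_of_ne hcard fun h => ?_)
    rw [← ht, ← h, Nat.mul_mod_left] at hres
    exact zero_ne_one hres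
  rw [le_div_iff₀ (by positivity), le_sub_iff_add_le]
  exact_mod_cast hlt
end
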